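/- Let N ≥ 3, let Ω ⊆ B be an open set, and let v : ℝ^N → ℝ be a smooth function with compact support contained in Ω. Set u(x) = ϱ(x)^{−(N−2)/2} v(x). Then ∫_Ω |∇u(x)|² ϱ(x)^{N−2} dx = ∫_Ω |∇v(x)|² dx + (N(N−2)/4) ∫_Ω v(x)² ϱ(x)² dx. -/

import Mathlib

open MeasureTheory Real RealInnerProductSpace

noncomputable section

/-- Euclidean space `ℝ^N`. -/
abbrev Euc (N : ℕ) := EuclideanSpace ℝ (Fin N)

/-- Conformal factor of the Poincaré ball model, `ϱ(x) = 2/(1 − |x|²)`. -/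
def rho {N : ℕ} (x : Euc N) : ℝ := 2 / (1 - ‖x‖ ^ 2)

/-- The spectral shift `λ₀ = N(N−2)/4`. -/
def lam0 (N : ℕ) : ℝ := (N : ℝ) * ((N : ℝ) - 2) / 4

/-- The critical Sobolev exponent `2* = 2N/(N−2)`. -/
def twoStar (N : ℕ) : ℝ := 2 * (N : ℝ) / ((N : ℝ) - 2)

/-- Euclidean divergence of a vector field: trace of the derivative. -/
def ediv {N : ℕ} (F : Euc N → Euc N) (x : Euc N) : ℝ :=
  ∑ i, ⟪fderiv ℝ F x (EuclideanSpace.single i 1), EuclideanSpace.single i 1⟫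

/-- Euclidean Laplacian of a real function: trace of the second derivative. -/
def lap {N : ℕ} (f : Euc N → ℝ) (x : Euc N) : ℝ :=
  ∑ i, fderiv ℝ (fun y => fderiv ℝ f y (EuclideanSpace.single i 1)) x
    (EuclideanSpace.single i 1)

lemma contDiff_rho_mul {N : ℕ} {w : Euc N → ℝ} (hw : ContDiff ℝ 1 w)
    (hws : tsupport w ⊆ {x : Euc N | ‖x‖ < 1}) : ContDiff ℝ 1 fun x => rho x * w x := by
  rw [contDiff_iff_contDiffAt]
  intro x
  by_cases hx : x ∈ tsupport w
  · have hx1 : ‖x‖ < 1 := hws hx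
    have h : 1 - ‖x‖ ^ 2 ≠ 0 := by nlinarith [norm_nonneg x]
    exact (contDiffAt_const.div (contDiffAt_const.sub (contDiff_norm_sq ℝ).contDiffAt) h).mul
      hw.contDiffAt
  · have h : (fun x => rho x * w x) =ᶠ[nhds x] fun _ => 0 := by
      filter_upwards [notMem_tsupport_iff_eventuallyEq.mp hx] with y hy
      simp [hy]
    exact contDiffAt_const.congr_of_eventuallyEq h

lemma hasFDerivAt_rho {N : ℕ} {x : Euc N} (hx : ‖x‖ < 1) :
    HasFDerivAt rho (rho x ^ 2 • innerSL ℝ x) x := by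
  have h : 1 - ‖x‖ ^ 2 ≠ 0 := by nlinarith [norm_nonneg x]
  have h1 := (hasDerivAt_inv h).comp_hasFDerivAt x
    ((hasStrictFDerivAt_norm_sq x).hasFDerivAt.const_sub (1 : ℝ))
  refine (h1.const_mul (2 : ℝ)).congr_fderiv ?_
  ext y
  simp [rho]
  field_simp

/-- The integral of the divergence of `x ↦ g x • x` vanishes for compactly supported `g`. -/
lemma integral_div_smul_id {N : ℕ} {g : Euc N → ℝ} (hg : ContDiff ℝ 1 g)
    (hgc : HasCompactSupport g) :
    ∫ x, ((N : ℝ) * g x + fderiv ℝ g x x) = 0 := by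
  have hd := hg.differentiable one_ne_zero
  have hF (i : Fin N) : ContDiff ℝ 1 fun x : Euc N => x i * g x := by fun_prop
  have hFc (i : Fin N) : HasCompactSupport fun x : Euc N => x i * g x := hgc.mul_left
  have hFi (i : Fin N) : Integrable fun x : Euc N =>
      fderiv ℝ (fun x : Euc N => x i * g x) x (EuclideanSpace.single i 1) :=
    ((hF i).continuous_fderiv_apply one_ne_zero |>.comp
      (continuous_id.prodMk continuous_const)).integrable_of_hasCompactSupport
      ((hFc i).fderiv_apply ℝ _)
  have hint (i : Fin N) :
      ∫ x : Euc N, fderiv ℝ (fun x : Euc N => x i * g x) x (EuclideanSpace.single i 1) = 0 := by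
    simpa using integral_mul_fderiv_eq_neg_fderiv_mul_of_integrable (𝕜 := ℝ)
      (f := fun _ : Euc N => (1 : ℝ)) (g := fun x : Euc N => x i * g x)
      (v := EuclideanSpace.single i 1) (μ := volume) (by simp) (by simpa using hFi i)
      (by simpa using (hF i).continuous.integrable_of_hasCompactSupport (hFc i))
      (by fun_prop)
      fun x _ => (hF i).differentiable one_ne_zero x
  have hsum (x : Euc N) : (N : ℝ) * g x + fderiv ℝ g x x =
      ∑ i, fderiv ℝ (fun x : Euc N => x i * g x) x (EuclideanSpace.single i 1) := by
    have hx : x = ∑ i, x i • EuclideanSpace.single i (1 : ℝ) := by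
      ext j
      simp [Finset.sum_apply, Pi.single_apply]
    have hi (i : Fin N) : fderiv ℝ (fun x : Euc N => x i * g x) x (EuclideanSpace.single i 1) =
        g x + x i * fderiv ℝ g x (EuclideanSpace.single i 1) := by
      have hp : HasFDerivAt (fun x : Euc N => x i) (EuclideanSpace.proj i : Euc N →L[ℝ] ℝ) x :=
        (EuclideanSpace.proj i : Euc N →L[ℝ] ℝ).hasFDerivAt
      have h : HasFDerivAt (fun x : Euc N => x i * g x) _ x := hp.mul (hd x).hasFDerivAt
      rw [h.fderiv]
      simp [add_comm]
    simp_rw [hi, Finset.sum_add_distrib]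
    have hL : fderiv ℝ g x x = ∑ i, x i * fderiv ℝ g x (EuclideanSpace.single i 1) := by
      conv_lhs => rw [congrArg (fderiv ℝ g x) hx]
      simp only [map_sum, map_smul, smul_eq_mul]
    simp [hL]
  simp_rw [hsum]
  rw [integral_finsetSum _ fun i _ => hFi i]
  simp [hint]

lemma norm_gradient_sq_mul_rho {N : ℕ} {v u : Euc N → ℝ} {a : ℝ} {x : Euc N} (hx : ‖x‖ < 1)
    (hv : DifferentiableAt ℝ v x) (hu : ∀ y, u y = rho y ^ (-a) * v y) :
    ‖gradient u x‖ ^ 2 * rho x ^ (2 * a) =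
      ‖gradient v x‖ ^ 2 - 2 * a * v x * rho x * fderiv ℝ v x x
        + a ^ 2 * v x ^ 2 * rho x ^ 2 * ‖x‖ ^ 2 := by
  have hρ : 0 < rho x := div_pos two_pos (by nlinarith [norm_nonneg x])
  have hgrad : gradient u x = rho x ^ (-a) • (gradient v x - (a * v x * rho x) • x) := by
    have h1 := ((hasFDerivAt_rho hx).rpow_const (p := -a) (Or.inl hρ.ne')).mul hv.hasFDerivAt
    have h2 : HasFDerivAt u _ x := h1.congr_of_eventuallyEq (.of_forall hu)
    have h3 : (InnerProductSpace.toDual ℝ (Euc N)).symm (innerSL ℝ x) = x :=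
      (InnerProductSpace.toDual ℝ (Euc N)).symm_apply_apply x
    have h4 : rho x ^ (-a - 1) * rho x ^ 2 = rho x ^ (-a) * rho x := by
      rw [rpow_sub_one hρ.ne']
      field_simp
    rw [gradient, h2.fderiv, gradient]
    simp only [map_add, map_smul, h3, smul_sub, smul_smul]
    rw [sub_eq_add_neg (_ • _), ← neg_smul]
    congr 2
    linear_combination (-a * v x) * h4
  have hinner : ⟪gradient v x, x⟫ = fderiv ℝ v x x := by
    rw [gradient, InnerProductSpace.toDual_symm_apply]
  have hpow : (rho x ^ (-a)) ^ 2 * rho x ^ (2 * a) = 1 := by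
    rw [← rpow_mul_natCast hρ.le, ← rpow_add hρ]
    simp [mul_comm]
  rw [hgrad, norm_smul, mul_pow, norm_sub_sq_real, norm_smul, inner_smul_right, hinner]
  simp only [mul_pow, norm_eq_abs, sq_abs]
  linear_combination (‖gradient v x‖ ^ 2 - 2 * a * v x * rho x * fderiv ℝ v x x
        + a ^ 2 * v x ^ 2 * rho x ^ 2 * ‖x‖ ^ 2) * hpow

/-- The weighted Dirichlet energy of `u = ϱ^{−(N−2)/2} v` equals the
Euclidean Dirichlet energy of `v` plus the conformal correction term. -/
theorem stmt_2 {N : ℕ} (hN : 3 ≤ N) (Ω : Set (Euc N)) (hΩ : IsOpen Ω)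
    (hΩB : Ω ⊆ {x : Euc N | ‖x‖ < 1}) (v : Euc N → ℝ)
    (hv : ContDiff ℝ (⊤ : ℕ∞) v) (hvc : HasCompactSupport v) (hvs : tsupport v ⊆ Ω)
    (u : Euc N → ℝ) (hu : ∀ y, u y = rho y ^ (-(((N : ℝ) - 2) / 2)) * v y) :
    ∫ x in Ω, ‖gradient u x‖ ^ 2 * rho x ^ ((N : ℝ) - 2)
      = (∫ x in Ω, ‖gradient v x‖ ^ 2)
        + ((N : ℝ) * ((N : ℝ) - 2) / 4) * ∫ x in Ω, v x ^ 2 * rho x ^ 2 := by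
  have hv1 : ContDiff ℝ 1 v := hv.of_le (by exact_mod_cast le_top)
  have hd : Differentiable ℝ v := hv1.differentiable one_ne_zero
  have hB {x : Euc N} (hx : x ∈ tsupport v) : ‖x‖ < 1 := hΩB (hvs hx)
  have hts {f : Euc N → ℝ} : tsupport (fun x => v x * f x) ⊆ {x : Euc N | ‖x‖ < 1} :=
    (tsupport_mul_subset_left.trans hvs).trans hΩB
  set g : Euc N → ℝ := fun x => rho x * (v x * v x) with hg
  have hgC : ContDiff ℝ 1 g := contDiff_rho_mul (hv1.mul hv1) hts
  have hgc : HasCompactSupport g := hvc.mul_left.mul_left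
  have hv0 {x : Euc N} (hx : x ∉ tsupport v) : v x = 0 := image_eq_zero_of_notMem_tsupport hx
  have hgrad0 {f : Euc N → ℝ} {x : Euc N} (hf : ∀ y, v y = 0 → f y = 0) (hx : x ∉ tsupport v) :
      fderiv ℝ f x = 0 := by
    have h : f =ᶠ[nhds x] fun _ => 0 := by
      filter_upwards [notMem_tsupport_iff_eventuallyEq.mp hx] with y hy
      exact hf y hy
    rw [h.fderiv_eq]
    simp
  have hu0 {x : Euc N} (hx : x ∉ tsupport v) : gradient u x = 0 := by
    simp [gradient, hgrad0 (f := u) (fun y hy => by simp [hu, hy]) hx]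
  have hgv0 {x : Euc N} (hx : x ∉ tsupport v) : gradient v x = 0 := by
    simp [gradient, hgrad0 (fun y hy => hy) hx]
  rw [setIntegral_eq_integral_of_forall_compl_eq_zero fun x hx => by simp [hu0 fun h => hx (hvs h)],
    setIntegral_eq_integral_of_forall_compl_eq_zero fun x hx => by simp [hgv0 fun h => hx (hvs h)],
    setIntegral_eq_integral_of_forall_compl_eq_zero fun x hx => by simp [hv0 fun h => hx (hvs h)]]
  have hg0 {x : Euc N} (hx : x ∉ tsupport v) : g x = 0 := by simp [hg, hv0 hx]
  have hgd0 {x : Euc N} (hx : x ∉ tsupport v) : fderiv ℝ g x = 0 :=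
    hgrad0 (fun y hy => by simp [hg, hy]) hx
  have hI1 : Integrable fun x => ‖gradient v x‖ ^ 2 := by
    have h : Continuous fun x => ‖fderiv ℝ v x‖ ^ 2 :=
      (hv1.continuous_fderiv one_ne_zero).norm.pow 2
    simp only [gradient, LinearIsometryEquiv.norm_map]
    exact h.integrable_of_hasCompactSupport
      ((hvc.fderiv ℝ).comp_left (g := fun L => ‖L‖ ^ 2) (by simp))
  have hI2 : Integrable fun x => v x ^ 2 * rho x ^ 2 := by
    have h := (contDiff_rho_mul hv1 (hvs.trans hΩB)).continuous.pow 2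
    have hc : HasCompactSupport fun x => (rho x * v x) ^ 2 :=
      .intro hvc fun x hx => by simp [hv0 hx]
    refine (h.integrable_of_hasCompactSupport hc).congr (.of_forall fun x => ?_)
    simp only [Pi.pow_apply]
    ring
  have hI3 : Integrable fun x => (N : ℝ) * g x + fderiv ℝ g x x := by
    have h : Continuous fun x => (N : ℝ) * g x + fderiv ℝ g x x :=
      (continuous_const.mul hgC.continuous).add
        ((hgC.continuous_fderiv one_ne_zero).clm_apply continuous_id)
    refine h.integrable_of_hasCompactSupport (.intro hvc fun x hx => ?_)
    simp [hgd0 hx, hg0 hx]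
  have key (x : Euc N) : ‖gradient u x‖ ^ 2 * rho x ^ ((N : ℝ) - 2) =
      ‖gradient v x‖ ^ 2 + ((N : ℝ) * ((N : ℝ) - 2) / 4) * (v x ^ 2 * rho x ^ 2)
        - (((N : ℝ) - 2) / 2) * ((N : ℝ) * g x + fderiv ℝ g x x) := by
    by_cases hx : x ∈ tsupport v
    · have hg' : fderiv ℝ g x x =
          rho x ^ 2 * ‖x‖ ^ 2 * v x ^ 2 + 2 * rho x * v x * fderiv ℝ v x x := by
        have h : HasFDerivAt g _ x :=
          (hasFDerivAt_rho (hB hx)).mul ((hd x).hasFDerivAt.mul (hd x).hasFDerivAt)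
        rw [h.fderiv]
        simp
        ring
      have hρ : rho x * (1 - ‖x‖ ^ 2) = 2 :=
        div_mul_cancel₀ _ (by nlinarith [norm_nonneg x, hB hx])
      have h := norm_gradient_sq_mul_rho (hB hx) (hd x) hu
      rw [show 2 * (((N : ℝ) - 2) / 2) = (N : ℝ) - 2 by ring] at h
      rw [h, hg']
      simp only [hg]
      linear_combination (-(N : ℝ) * ((N : ℝ) - 2) / 4 * v x ^ 2 * rho x) * hρ
    · simp [hu0 hx, hgv0 hx, hv0 hx, hg0 hx, hgd0 hx]
  simp_rw [key]
  rw [integral_sub (hI1.fun_add (hI2.const_mul _)) (hI3.const_mul _),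
    integral_add hI1 (hI2.const_mul _), integral_const_mul, integral_const_mul,
    integral_div_smul_id hgC hgc]
  ring
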